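/- Let τ be an ordering of a finite set N with |N| = n and let r ≤ n be a nonnegative integer. Then the number of orderings τ′ of N with Insert(τ, τ′) ≤ r is at most C(n, r) · n^r, where C(n, r) is the binomial coefficient. -/

import Mathlib

/-- One insert operation: remove an element and reinsert it at an arbitrary position. -/
def insertStep {α : Type*} (l l' : List α) : Prop :=
  ∃ (x : α) (l₁ l₂ m₁ m₂ : List α),
    l = l₁ ++ x :: l₂ ∧ l' = m₁ ++ x :: m₂ ∧ l₁ ++ l₂ = m₁ ++ m₂

/-- `reachN step r a b` holds if `b` is reachable from `a` in exactly `r` steps. -/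
def reachN {β : Type*} (step : β → β → Prop) : ℕ → β → β → Prop
  | 0 => Eq
  | n + 1 => fun a c => ∃ b, step a b ∧ reachN step n b c

/-- The insert distance: minimum number of insert operations transforming `τ` into `τ'`. -/
noncomputable def InsertDist {α : Type*} (τ τ' : List α) : ℕ :=
  sInf {r | reachN insertStep r τ τ'}

theorem insertStep.cons {α : Type*} (a : α) {l l' : List α} (h : insertStep l l') :
    insertStep (a :: l) (a :: l') := by
  obtain ⟨x, l₁, l₂, m₁, m₂, rfl, rfl, h⟩ := h
  exact ⟨x, a :: l₁, l₂, a :: m₁, m₂, rfl, rfl, by simp [h]⟩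

theorem reachN.map {β γ : Type*} {step : β → β → Prop} {step' : γ → γ → Prop} (f : β → γ)
    (hf : ∀ a b, step a b → step' (f a) (f b)) {k : ℕ} {a b : β} (h : reachN step k a b) :
    reachN step' k (f a) (f b) := by
  induction k generalizing a with
  | zero => exact congrArg f h
  | succ k ih =>
    obtain ⟨c, hac, hcb⟩ := h
    exact ⟨f c, hf _ _ hac, ih hcb⟩

theorem reachN.trans {β : Type*} {step : β → β → Prop} {j k : ℕ} {a b c : β}
    (hab : reachN step j a b) (hbc : reachN step k b c) : ∃ m, reachN step m a c := by
  induction j generalizing a with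
  | zero =>
    obtain rfl : a = b := hab
    exact ⟨k, hbc⟩
  | succ j ih =>
    obtain ⟨d, had, hdb⟩ := hab
    obtain ⟨m, hm⟩ := ih hdb
    exact ⟨m + 1, d, had, hm⟩

/-- Any two permutations of each other are connected by insert operations. -/
theorem List.Perm.exists_reachN_insertStep {α : Type*} {l l' : List α} (h : l.Perm l') :
    ∃ k, reachN insertStep k l l' := by
  induction h with
  | nil => exact ⟨0, rfl⟩
  | cons x _ ih =>
    obtain ⟨k, hk⟩ := ih
    exact ⟨k, hk.map (List.cons x) fun _ _ => insertStep.cons x⟩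
  | swap x y l => exact ⟨1, x :: y :: l, ⟨y, [], x :: l, [x], l, rfl, rfl, rfl⟩, rfl⟩
  | trans _ _ ih₁ ih₂ =>
    obtain ⟨j, hj⟩ := ih₁
    obtain ⟨k, hk⟩ := ih₂
    exact hj.trans hk

theorem List.Sublist.exists_sublist_append {α : Type*} {x : α} {l m₁ m₂ : List α}
    (h : l.Sublist (m₁ ++ x :: m₂)) :
    ∃ l' : List α, l'.Sublist l ∧ l'.Sublist (m₁ ++ m₂) ∧ l.length ≤ l'.length + 1 := by
  obtain ⟨p, q, rfl, hp, hq⟩ := List.sublist_append_iff.1 h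
  rcases List.sublist_cons_iff.1 hq with hq | ⟨q', rfl, hq'⟩
  · exact ⟨p ++ q, List.Sublist.refl _, hp.append hq, Nat.le_succ _⟩
  · exact ⟨p ++ q', (List.Sublist.refl p).append (List.sublist_cons_self x q'), hp.append hq',
      by simp [Nat.add_assoc]⟩

/-- Lists at `k` insert operations from each other share a sublist missing at most `k` elements. -/
theorem reachN.exists_common_sublist {α : Type*} {k : ℕ} {a b : List α}
    (h : reachN insertStep k a b) :
    ∃ l : List α, l.Sublist a ∧ l.Sublist b ∧ a.length ≤ l.length + k := by
  induction k generalizing a with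
  | zero =>
    obtain rfl : a = b := h
    exact ⟨a, List.Sublist.refl _, List.Sublist.refl _, le_rfl⟩
  | succ k ih =>
    obtain ⟨c, ⟨x, l₁, l₂, m₁, m₂, rfl, rfl, h⟩, hcb⟩ := h
    obtain ⟨l, hlc, hlb, hlen⟩ := ih hcb
    obtain ⟨l', hl', hm, hlen'⟩ := hlc.exists_sublist_append
    refine ⟨l', ?_, hl'.trans hlb, ?_⟩
    · rw [← h] at hm
      exact hm.trans ((List.Sublist.refl l₁).append (List.sublist_cons_self x l₂))
    · have := congrArg List.length h
      simp only [List.length_append, List.length_cons] at this hlen ⊢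
      omega

theorem List.insertIdx_length_append {α : Type*} (x : α) (l₁ l₂ : List α) :
    (l₁ ++ l₂).insertIdx l₁.length x = l₁ ++ x :: l₂ := by
  induction l₁ with
  | nil => simp
  | cons a l ih => simpa using ih

/-- The orderings of `l ++ R` that extend `l` number at most `N ^ R.length` when
`(l ++ R).length ≤ N`. -/
theorem exists_finset_perm_append_of_sublist {α : Type*} (N : ℕ) (l R : List α)
    (hnd : (l ++ R).Nodup) (hN : (l ++ R).length ≤ N) :
    ∃ F : Finset (List α), F.card ≤ N ^ R.length ∧
      ∀ t : List α, (l ++ R).Perm t → l.Sublist t → t ∈ F := by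
  classical
  induction R with
  | nil =>
    refine ⟨{l}, by simp, fun t hp hs => ?_⟩
    rw [List.append_nil] at hp
    simp [hs.eq_of_length hp.length_eq]
  | cons x R ih =>
    have hmid : (l ++ x :: R).Perm (x :: (l ++ R)) := List.perm_middle
    have hnd' := hmid.nodup_iff.1 hnd
    rw [List.nodup_cons] at hnd'
    have hlen := hmid.length_eq
    rw [List.length_cons] at hlen
    obtain ⟨F, hF, hmem⟩ := ih hnd'.2 (by omega)
    refine ⟨(Finset.range N ×ˢ F).image fun p => p.2.insertIdx p.1 x, ?_, fun t hp hs => ?_⟩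
    · refine Finset.card_image_le.trans ?_
      rw [Finset.card_product, Finset.card_range, List.length_cons, pow_succ']
      exact Nat.mul_le_mul_left _ hF
    · have hxl : x ∉ l := fun h => hnd'.1 (List.mem_append_left R h)
      have hxt : x ∈ t := hp.mem_iff.1 (by simp)
      obtain ⟨t₁, t₂, rfl⟩ := List.append_of_mem hxt
      have hp' : (l ++ R).Perm (t₁ ++ t₂) :=
        (hmid.symm.trans (hp.trans List.perm_middle)).cons_inv
      have hs' : l.Sublist (t₁ ++ t₂) := by
        obtain ⟨p, q, rfl, hp, hq⟩ := List.sublist_append_iff.1 hs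
        rcases List.sublist_cons_iff.1 hq with hq | ⟨q', rfl, -⟩
        · exact hp.append hq
        · simp at hxl
      refine Finset.mem_image.2 ⟨(t₁.length, t₁ ++ t₂), ?_, ?_⟩
      · refine Finset.mem_product.2 ⟨Finset.mem_range.2 ?_, hmem _ hp' hs'⟩
        have := hp'.length_eq
        simp only [List.length_append] at this hlen hN ⊢
        omega
      · exact List.insertIdx_length_append x t₁ t₂

/-- The number of orderings `τ'` of the same finite set with
`Insert(τ, τ') ≤ r` is at most `C(n, r) · n^r`. -/
theorem stmt12 {α : Type*} (τ : List α) (h1 : τ.Nodup) (r : ℕ) (hr : r ≤ τ.length) :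
    Set.ncard {τ' : List α | τ.Perm τ' ∧ InsertDist τ τ' ≤ r}
      ≤ (τ.length).choose r * τ.length ^ r := by
  classical
  have hex : ∀ l : List α, ∃ F : Finset (List α), l ∈ τ.sublistsLen (τ.length - r) →
      F.card ≤ τ.length ^ r ∧ ∀ t : List α, τ.Perm t → l.Sublist t → t ∈ F := by
    intro l
    by_cases hl : l ∈ τ.sublistsLen (τ.length - r)
    · obtain ⟨hsub, hlen⟩ := List.mem_sublistsLen.1 hl
      obtain ⟨R, hR⟩ := hsub.exists_perm_append
      have hlenR := hR.length_eq
      obtain ⟨F, hF, hmem⟩ := exists_finset_perm_append_of_sublist τ.length l R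
        (hR.nodup_iff.1 h1) hlenR.ge
      rw [List.length_append] at hlenR
      have hRr : R.length = r := by omega
      exact ⟨F, fun _ => ⟨hRr ▸ hF, fun t ht => hmem t (hR.symm.trans ht)⟩⟩
    · exact ⟨∅, fun h => absurd h hl⟩
  choose F hF using hex
  have hsubset : {τ' : List α | τ.Perm τ' ∧ InsertDist τ τ' ≤ r} ⊆
      ((τ.sublistsLen (τ.length - r)).toFinset.biUnion F : Finset (List α)) := by
    rintro t ⟨hp, hd⟩
    have hreach : reachN insertStep (InsertDist τ t) τ t :=
      Nat.sInf_mem (s := {k | reachN insertStep k τ t}) hp.exists_reachN_insertStep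
    obtain ⟨l, hlτ, hlt, hlen⟩ := hreach.exists_common_sublist
    have htake := List.take_sublist (τ.length - r) l
    have hl : l.take (τ.length - r) ∈ τ.sublistsLen (τ.length - r) :=
      List.mem_sublistsLen.2 ⟨htake.trans hlτ, by rw [List.length_take]; omega⟩
    exact Finset.mem_coe.2 (Finset.mem_biUnion.2
      ⟨_, List.mem_toFinset.2 hl, (hF _ hl).2 t hp (htake.trans hlt)⟩)
  refine (Set.ncard_le_ncard hsubset (Finset.finite_toSet _)).trans ?_
  rw [Set.ncard_coe_finset]
  refine (Finset.card_biUnion_le_card_mul _ F _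
    fun l hl => (hF l (List.mem_toFinset.1 hl)).1).trans ?_
  refine Nat.mul_le_mul_right _ ((List.toFinset_card_le _).trans ?_)
  rw [List.length_sublistsLen, Nat.choose_symm hr]
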